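/- Let 𝔠 > 0, T > 0, z := 𝔠²/T, u ∈ ℝ³, u₀ := √(𝔠²+|u|²), and for p ∈ ℝ³ set p₀ := √(𝔠²+|p|²) and J(p) := (z/(4π𝔠³K₂(z))) · exp(−z(p₀u₀ − p·u)/𝔠²). Then ∫_{ℝ³} J(p) dp = u₀/𝔠, and for each i ∈ {1,2,3}: ∫_{ℝ³} (pᵢ/p₀) J(p) dp = uᵢ/𝔠. -/

import Mathlib

open MeasureTheory

/-- The Euclidean norm on ℝ³. -/
noncomputable def norm3 (p : Fin 3 → ℝ) : ℝ := Real.sqrt (p 0 ^ 2 + p 1 ^ 2 + p 2 ^ 2)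

/-- The Euclidean inner product on ℝ³. -/
def dot3 (p q : Fin 3 → ℝ) : ℝ := p 0 * q 0 + p 1 * q 1 + p 2 * q 2

/-- The modified Bessel function K_α(z) = ∫₀^∞ e^{−z cosh t} cosh(αt) dt. -/
noncomputable def Kb (α z : ℝ) : ℝ :=
  ∫ t in Set.Ioi (0 : ℝ), Real.exp (-z * Real.cosh t) * Real.cosh (α * t)

/-- The relativistic Maxwellian (Jüttner distribution) with density 1, bulk velocity u and
temperature T, where z = c²/T:
J(p) = (z/(4πc³K₂(z))) exp(−z(p₀u₀ − p·u)/c²). -/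
noncomputable def Jutt (c T : ℝ) (u p : Fin 3 → ℝ) : ℝ :=
  (c ^ 2 / T) / (4 * Real.pi * c ^ 3 * Kb 2 (c ^ 2 / T)) *
    Real.exp (-(c ^ 2 / T) *
      (Real.sqrt (c ^ 2 + norm3 p ^ 2) * Real.sqrt (c ^ 2 + norm3 u ^ 2) - dot3 p u) /
        c ^ 2)

open Set Filter Topology

/-- The energy `p₀ = √(c² + |p|²)` of a particle of momentum `p`. -/
noncomputable def energy (c : ℝ) (p : Fin 3 → ℝ) : ℝ := Real.sqrt (c ^ 2 + norm3 p ^ 2)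

/-- The Lorentz boost to the frame moving with bulk velocity `u`, acting on momenta. -/
noncomputable def boost (c : ℝ) (u p : Fin 3 → ℝ) : Fin 3 → ℝ :=
  p + (dot3 p u / (c * (c + energy c u)) - energy c p / c) • u

lemma norm3_sq (p : Fin 3 → ℝ) : norm3 p ^ 2 = p 0 ^ 2 + p 1 ^ 2 + p 2 ^ 2 :=
  Real.sq_sqrt (by positivity)

lemma energy_sq (c : ℝ) (p : Fin 3 → ℝ) :
    energy c p ^ 2 = c ^ 2 + (p 0 ^ 2 + p 1 ^ 2 + p 2 ^ 2) := by
  rw [energy, Real.sq_sqrt (by positivity), norm3_sq]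

lemma energy_pos {c : ℝ} (hc : 0 < c) (p : Fin 3 → ℝ) : 0 < energy c p :=
  Real.sqrt_pos.2 (by positivity)

lemma energy_neg (c : ℝ) (p : Fin 3 → ℝ) : energy c (-p) = energy c p := by
  simp [energy, norm3]

lemma abs_dot3_lt {c : ℝ} (hc : 0 < c) (p q : Fin 3 → ℝ) :
    |dot3 p q| < energy c p * energy c q := by
  apply abs_lt_of_sq_lt_sq _ (mul_pos (energy_pos hc p) (energy_pos hc q)).le
  rw [mul_pow, energy_sq, energy_sq, dot3]
  have : 0 < c ^ 2 * c ^ 2 + c ^ 2 * (p 0 ^ 2 + p 1 ^ 2 + p 2 ^ 2)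
      + c ^ 2 * (q 0 ^ 2 + q 1 ^ 2 + q 2 ^ 2) := by positivity
  nlinarith [sq_nonneg (p 0 * q 1 - p 1 * q 0), sq_nonneg (p 0 * q 2 - p 2 * q 0),
    sq_nonneg (p 1 * q 2 - p 2 * q 1)]

lemma energy_boost {c : ℝ} (hc : 0 < c) (u p : Fin 3 → ℝ) :
    energy c (boost c u p) = (energy c p * energy c u - dot3 p u) / c := by
  have hlt := (abs_lt.1 (abs_dot3_lt hc p u)).2
  refine (sq_eq_sq₀ (energy_pos hc _).le (div_nonneg (by linarith) hc.le)).1 ?_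
  have hp := energy_sq c p
  have hu := energy_sq c u
  have hpos := energy_pos hc u
  rw [energy_sq]
  simp only [boost, Pi.add_apply, Pi.smul_apply, smul_eq_mul]
  set e := energy c p
  set w := energy c u
  have hd : dot3 p u = p 0 * u 0 + p 1 * u 1 + p 2 * u 2 := rfl
  set d := dot3 p u
  have hφ : ((e * w - d) / c) ^ 2 = e ^ 2 + 2 * (d / (c * (c + w)) - e / c) * d
      + (d / (c * (c + w)) - e / c) ^ 2 * (w ^ 2 - c ^ 2) := by
    field_simp
    ring
  rw [hφ]
  set φ := d / (c * (c + w)) - e / c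
  linear_combination (-1) * hp - φ ^ 2 * hu - 2 * φ * hd

lemma boost_neg_boost {c : ℝ} (hc : 0 < c) (u p : Fin 3 → ℝ) :
    boost c (-u) (boost c u p) = p := by
  have hu := energy_sq c u
  have hpos := energy_pos hc u
  have hdot : dot3 (boost c u p) (-u) =
      -(dot3 p u + (dot3 p u / (c * (c + energy c u)) - energy c p / c)
        * (energy c u ^ 2 - c ^ 2)) := by
    rw [hu]
    simp only [boost, Pi.add_apply, Pi.smul_apply, smul_eq_mul, dot3, Pi.neg_apply]
    ring
  rw [boost, energy_neg, energy_boost hc, hdot]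
  rw [boost]
  have key : -(dot3 p u + (dot3 p u / (c * (c + energy c u)) - energy c p / c)
        * (energy c u ^ 2 - c ^ 2)) / (c * (c + energy c u))
      - (energy c p * energy c u - dot3 p u) / c / c =
      dot3 p u / (c * (c + energy c u)) - energy c p / c := by
    field_simp
    ring
  rw [key]
  simp

lemma boost_boost_neg {c : ℝ} (hc : 0 < c) (u p : Fin 3 → ℝ) :
    boost c u (boost c (-u) p) = p := by
  simpa using boost_neg_boost hc (-u) p

/-- The inner product with a fixed vector, as a continuous linear functional. -/
noncomputable def dot3CLM (u : Fin 3 → ℝ) : (Fin 3 → ℝ) →L[ℝ] ℝ :=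
  u 0 • ContinuousLinearMap.proj 0 + u 1 • ContinuousLinearMap.proj 1
    + u 2 • ContinuousLinearMap.proj 2

lemma dot3CLM_apply (u p : Fin 3 → ℝ) : dot3CLM u p = dot3 p u := by
  simp [dot3CLM, dot3, mul_comm]

lemma continuous_dot3 (u : Fin 3 → ℝ) : Continuous fun p => dot3 p u := by
  unfold dot3
  fun_prop

lemma continuous_energy (c : ℝ) : Continuous (energy c) := by
  unfold energy norm3
  fun_prop

lemma hasFDerivAt_energy {c : ℝ} (hc : 0 < c) (p : Fin 3 → ℝ) :
    HasFDerivAt (energy c) ((1 / energy c p) • dot3CLM p) p := by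
  have hfun : energy c = fun p : Fin 3 → ℝ =>
      Real.sqrt (c ^ 2 + (p 0 ^ 2 + p 1 ^ 2 + p 2 ^ 2)) := by
    ext q
    rw [energy, norm3_sq]
  have hp (i : Fin 3) : HasFDerivAt (fun p : Fin 3 → ℝ => p i)
      (ContinuousLinearMap.proj (R := ℝ) (φ := fun _ : Fin 3 => ℝ) i) p := hasFDerivAt_apply i p
  have h := (((((hp 0).pow 2).add ((hp 1).pow 2)).add ((hp 2).pow 2)).const_add (c ^ 2)).sqrt
    (by simp only [Pi.add_apply]; positivity)
  have he : energy c p ≠ 0 := (energy_pos hc p).ne'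
  rw [hfun] at he ⊢
  refine h.congr_fderiv ?_
  ext v
  simp [dot3CLM]
  ring

lemma hasFDerivAt_boost {c : ℝ} (hc : 0 < c) (u p : Fin 3 → ℝ) :
    HasFDerivAt (boost c u) (ContinuousLinearMap.id ℝ _ +
      ((1 / (c * (c + energy c u))) • dot3CLM u
        - (1 / c) • (1 / energy c p) • dot3CLM p).smulRight u) p := by
  have h1 : HasFDerivAt (fun p => (1 / (c * (c + energy c u))) • dot3CLM u p
      - (1 / c) • energy c p) ((1 / (c * (c + energy c u))) • dot3CLM u
        - (1 / c) • (1 / energy c p) • dot3CLM p) p :=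
    ((dot3CLM u).hasFDerivAt.const_smul (1 / (c * (c + energy c u)))).sub ((hasFDerivAt_energy hc p).const_smul (1 / c))
  have h2 := (hasFDerivAt_id (𝕜 := ℝ) p).add (h1.smul_const u)
  refine h2.congr_of_eventuallyEq (Eventually.of_forall fun q => ?_)
  simp only [boost, Pi.add_apply, id, dot3CLM_apply, smul_eq_mul]
  congr 2
  ring

lemma det_fderiv_boost {c : ℝ} (hc : 0 < c) (u p : Fin 3 → ℝ) :
    (ContinuousLinearMap.id ℝ _ +
      ((1 / (c * (c + energy c u))) • dot3CLM u
        - (1 / c) • (1 / energy c p) • dot3CLM p).smulRight u).det =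
      energy c (boost c u p) / energy c p := by
  set ℓ := (1 / (c * (c + energy c u))) • dot3CLM u
        - (1 / c) • (1 / energy c p) • dot3CLM p with hℓ
  have : ((ContinuousLinearMap.id ℝ (Fin 3 → ℝ) + ℓ.smulRight u :
      (Fin 3 → ℝ) →L[ℝ] (Fin 3 → ℝ)) : (Fin 3 → ℝ) →ₗ[ℝ] (Fin 3 → ℝ)) =
      LinearMap.transvection (ℓ : (Fin 3 → ℝ) →ₗ[ℝ] ℝ) u := by
    ext v
    simp [LinearMap.transvection]
  rw [ContinuousLinearMap.det, this, LinearMap.transvection.det, energy_boost hc]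
  have hu := energy_sq c u
  have h1 := energy_pos hc u
  have h2 := energy_pos hc p
  have hd : dot3 u u = energy c u ^ 2 - c ^ 2 := by rw [hu, dot3]; ring
  have hs : dot3 u p = dot3 p u := by simp only [dot3]; ring
  simp only [hℓ, ContinuousLinearMap.coe_coe, sub_apply, smul_apply, dot3CLM_apply, hd, hs,
    smul_eq_mul]
  field_simp
  ring

lemma integral_comp_boost {c : ℝ} (hc : 0 < c) (u : Fin 3 → ℝ) (g : (Fin 3 → ℝ) → ℝ) :
    ∫ p, energy c (boost c u p) / energy c p * g (boost c u p) = ∫ q, g q := by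
  have hinj : Function.Injective (boost c u) :=
    Function.LeftInverse.injective (boost_neg_boost hc u)
  have hsurj : Function.Surjective (boost c u) :=
    Function.RightInverse.surjective (boost_boost_neg hc u)
  have h := integral_image_eq_integral_abs_det_fderiv_smul volume MeasurableSet.univ
    (fun p _ => (hasFDerivAt_boost hc u p).hasFDerivWithinAt) hinj.injOn g
  simp only [image_univ, hsurj.range_eq, Measure.restrict_univ, det_fderiv_boost hc,
    smul_eq_mul] at h
  rw [h]
  congr with p
  rw [abs_of_pos (div_pos (energy_pos hc _) (energy_pos hc _))]

lemma exp_neg_mul_cosh_le {z t : ℝ} (hz : 0 < z) (ht : 0 ≤ t) :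
    Real.exp (-z * Real.cosh t) ≤ Real.exp (16 / z) * Real.exp (-4 * t) := by
  rw [← Real.exp_add, Real.exp_le_exp]
  have h1 := Real.quadratic_le_exp_of_nonneg ht
  have h2 : t ^ 2 / 4 ≤ Real.cosh t := by
    rw [Real.cosh_eq]
    linarith [Real.exp_pos (-t)]
  have h3 : z * (t ^ 2 / 4) ≤ z * Real.cosh t := by gcongr
  have h4 : z * (t ^ 2 / 4) + 16 / z - 4 * t = (z * t / 2 - 4) ^ 2 / z := by
    field_simp
    ring
  have h5 : 0 ≤ (z * t / 2 - 4) ^ 2 / z := by positivity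
  linarith

lemma abs_exp_neg_mul_cosh_mul_le {z t : ℝ} (hz : 0 < z) (ht : 0 ≤ t) {y : ℝ}
    (hy : |y| ≤ Real.exp (3 * t)) :
    |Real.exp (-z * Real.cosh t) * y| ≤ Real.exp (16 / z) * Real.exp (-t) := by
  rw [abs_mul, abs_of_pos (Real.exp_pos _)]
  calc _ ≤ Real.exp (16 / z) * Real.exp (-4 * t) * Real.exp (3 * t) := by
        gcongr
        exact exp_neg_mul_cosh_le hz ht
    _ = _ := by
        rw [mul_assoc, ← Real.exp_add]
        ring_nf

lemma integrableOn_exp_neg_mul_cosh_mul {z : ℝ} (hz : 0 < z) {f : ℝ → ℝ} (hf : Continuous f)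
    (hle : ∀ t, 0 ≤ t → |f t| ≤ Real.exp (3 * t)) :
    IntegrableOn (fun t => Real.exp (-z * Real.cosh t) * f t) (Ioi 0) := by
  refine Integrable.mono' ((integrableOn_exp_neg_Ioi 0).const_mul (Real.exp (16 / z)))
    (by fun_prop) ?_
  filter_upwards [self_mem_ae_restrict measurableSet_Ioi] with t ht
  exact abs_exp_neg_mul_cosh_mul_le hz (le_of_lt ht) (hle t (le_of_lt ht))

lemma tendsto_exp_neg_mul_cosh_mul {z : ℝ} (hz : 0 < z) {f : ℝ → ℝ}
    (hle : ∀ t, 0 ≤ t → |f t| ≤ Real.exp (3 * t)) :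
    Tendsto (fun t => Real.exp (-z * Real.cosh t) * f t) atTop (𝓝 0) := by
  refine squeeze_zero_norm' (a := fun t => Real.exp (16 / z) * Real.exp (-t)) ?_ ?_
  · filter_upwards [eventually_ge_atTop 0] with t ht
    exact abs_exp_neg_mul_cosh_mul_le hz ht (hle t ht)
  · simpa using (Real.tendsto_exp_neg_atTop_nhds_zero).const_mul (Real.exp (16 / z))

lemma cosh_le_exp {t : ℝ} (ht : 0 ≤ t) : Real.cosh t ≤ Real.exp t := by
  rw [← Real.cosh_add_sinh]
  linarith [Real.sinh_nonneg_iff.2 ht]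

lemma sinh_le_exp (t : ℝ) : Real.sinh t ≤ Real.exp t := by
  rw [← Real.cosh_add_sinh]
  linarith [Real.cosh_pos t]

lemma abs_cosh_two_mul_le {t : ℝ} (ht : 0 ≤ t) :
    |Real.cosh (2 * t)| ≤ Real.exp (3 * t) := by
  rw [abs_of_pos (Real.cosh_pos _)]
  exact (cosh_le_exp (by linarith)).trans (Real.exp_le_exp.2 (by linarith))

lemma abs_sinh_sq_mul_cosh_le {t : ℝ} (ht : 0 ≤ t) :
    |Real.sinh t ^ 2 * Real.cosh t| ≤ Real.exp (3 * t) := by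
  have hs := Real.sinh_nonneg_iff.2 ht
  have hc := Real.cosh_pos t
  rw [abs_of_nonneg (by positivity)]
  calc _ ≤ Real.exp t ^ 2 * Real.exp t := by
        gcongr
        · exact sinh_le_exp t
        · exact cosh_le_exp ht
    _ = _ := by
        rw [← pow_succ, ← Real.exp_nat_mul]
        norm_num

lemma abs_sinh_mul_cosh_le {t : ℝ} (ht : 0 ≤ t) :
    |Real.sinh t * Real.cosh t| ≤ Real.exp (3 * t) := by
  have hs := Real.sinh_nonneg_iff.2 ht
  have hc := Real.cosh_pos t
  rw [abs_of_nonneg (by positivity)]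
  calc _ ≤ Real.exp t * Real.exp t := by
        gcongr
        · exact sinh_le_exp t
        · exact cosh_le_exp ht
    _ ≤ _ := by
        rw [← Real.exp_add, Real.exp_le_exp]
        linarith

lemma Kb_two_pos {z : ℝ} (hz : 0 < z) : 0 < Kb 2 z := by
  have hpos (t : ℝ) : 0 < Real.exp (-z * Real.cosh t) * Real.cosh (2 * t) := by positivity
  rw [Kb, setIntegral_pos_iff_support_of_nonneg_ae (Eventually.of_forall fun t => (hpos t).le)
    (integrableOn_exp_neg_mul_cosh_mul hz (by fun_prop) fun _ => abs_cosh_two_mul_le)]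
  have : Function.support (fun t => Real.exp (-z * Real.cosh t) * Real.cosh (2 * t)) = univ :=
    eq_univ_of_forall fun t => (hpos t).ne'
  rw [this]
  simp

lemma Kb_two_eq {z : ℝ} (hz : 0 < z) :
    Kb 2 z = z * ∫ t in Ioi (0 : ℝ),
      Real.exp (-z * Real.cosh t) * (Real.sinh t ^ 2 * Real.cosh t) := by
  have i1 := integrableOn_exp_neg_mul_cosh_mul hz (f := fun t => Real.cosh (2 * t))
    (by fun_prop) fun _ => abs_cosh_two_mul_le
  have i2 := (integrableOn_exp_neg_mul_cosh_mul hz (f := fun t => Real.sinh t ^ 2 * Real.cosh t)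
    (by fun_prop) fun _ => abs_sinh_sq_mul_cosh_le).const_mul z
  have h := integral_Ioi_of_hasDerivAt_of_tendsto' (a := 0) (m := 0)
    (f := fun t => Real.exp (-z * Real.cosh t) * (Real.sinh t * Real.cosh t))
    (fun t _ => ?_) (i1.sub i2) (tendsto_exp_neg_mul_cosh_mul hz fun _ => abs_sinh_mul_cosh_le)
  · rw [integral_sub' i1 i2, integral_const_mul] at h
    simp only [Real.sinh_zero, zero_mul, mul_zero, sub_zero] at h
    rw [Kb]
    linarith
  · have := ((Real.hasDerivAt_cosh t).const_mul (-z)).exp.mul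
      ((Real.hasDerivAt_sinh t).mul (Real.hasDerivAt_cosh t))
    refine this.congr_deriv ?_
    simp only [Pi.sub_apply, Pi.mul_apply, Real.cosh_two_mul]
    ring

lemma image_mul_sinh_Ioi {c : ℝ} (hc : 0 < c) : (fun t => c * Real.sinh t) '' Ioi 0 = Ioi 0 := by
  ext r
  constructor
  · rintro ⟨t, ht, rfl⟩
    exact mul_pos hc (Real.sinh_pos_iff.2 ht)
  · intro hr
    refine ⟨Real.arsinh (r / c), Real.arsinh_pos_iff.2 (div_pos hr hc), ?_⟩
    simp only [Real.sinh_arsinh]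
    field_simp

lemma sqrt_sq_add_mul_sinh_sq {c : ℝ} (hc : 0 < c) (t : ℝ) :
    Real.sqrt (c ^ 2 + (c * Real.sinh t) ^ 2) = c * Real.cosh t := by
  rw [← Real.sqrt_sq (mul_pos hc (Real.cosh_pos t)).le]
  congr 1
  rw [mul_pow, mul_pow, Real.cosh_sq]
  ring

lemma radial_substitution {c z : ℝ} (hc : 0 < c) (t : ℝ) :
    |c * Real.cosh t| • ((c * Real.sinh t) ^ 2 •
      Real.exp (-z / c * Real.sqrt (c ^ 2 + (c * Real.sinh t) ^ 2))) =
    c ^ 3 * (Real.exp (-z * Real.cosh t) * (Real.sinh t ^ 2 * Real.cosh t)) := by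
  rw [sqrt_sq_add_mul_sinh_sq hc, abs_of_pos (mul_pos hc (Real.cosh_pos t)),
    show -z / c * (c * Real.cosh t) = -z * Real.cosh t by field_simp]
  simp only [smul_eq_mul]
  ring

lemma integrableOn_radial {c z : ℝ} (hc : 0 < c) (hz : 0 < z) :
    IntegrableOn (fun r : ℝ => r ^ 2 • Real.exp (-z / c * Real.sqrt (c ^ 2 + r ^ 2))) (Ioi 0) := by
  rw [← image_mul_sinh_Ioi hc, integrableOn_image_iff_integrableOn_abs_deriv_smul measurableSet_Ioi
    (fun t _ => ((Real.hasDerivAt_sinh t).const_mul c).hasDerivWithinAt)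
    (fun a _ b _ h => Real.sinh_injective (mul_left_cancel₀ hc.ne' h))]
  simp only [radial_substitution hc]
  exact (integrableOn_exp_neg_mul_cosh_mul hz (by fun_prop)
    fun _ => abs_sinh_sq_mul_cosh_le).const_mul _

lemma integral_radial {c z : ℝ} (hc : 0 < c) (hz : 0 < z) :
    ∫ r in Ioi (0 : ℝ), r ^ 2 • Real.exp (-z / c * Real.sqrt (c ^ 2 + r ^ 2)) =
      c ^ 3 * Kb 2 z / z := by
  rw [Kb_two_eq hz, ← image_mul_sinh_Ioi hc, integral_image_eq_integral_abs_deriv_smul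
    measurableSet_Ioi
    (fun t _ => ((Real.hasDerivAt_sinh t).const_mul c).hasDerivWithinAt)
    (fun a _ b _ h => Real.sinh_injective (mul_left_cancel₀ hc.ne' h)),
    image_mul_sinh_Ioi hc]
  simp only [radial_substitution hc]
  rw [integral_const_mul]
  field_simp

lemma energy_ofLp (c : ℝ) (x : EuclideanSpace ℝ (Fin 3)) :
    energy c x.ofLp = Real.sqrt (c ^ 2 + ‖x‖ ^ 2) := by
  rw [energy, norm3_sq, EuclideanSpace.norm_sq_eq, Fin.sum_univ_three]
  simp

lemma integrable_exp_energy {c z : ℝ} (hc : 0 < c) (hz : 0 < z) :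
    Integrable fun p : Fin 3 → ℝ => Real.exp (-z / c * energy c p) := by
  rw [← (EuclideanSpace.volume_preserving_symm_measurableEquiv_toLp (Fin 3)).integrable_comp_emb
    (MeasurableEquiv.measurableEmbedding _)]
  have h := (integrable_fun_norm_addHaar (volume : Measure (EuclideanSpace ℝ (Fin 3)))
    (f := fun r => Real.exp (-z / c * Real.sqrt (c ^ 2 + r ^ 2)))).2
    (by simpa using integrableOn_radial hc hz)
  simp only [← energy_ofLp] at h
  exact h

lemma integral_exp_energy {c z : ℝ} (hc : 0 < c) (hz : 0 < z) :
    ∫ p : Fin 3 → ℝ, Real.exp (-z / c * energy c p) = 4 * Real.pi * c ^ 3 * Kb 2 z / z := by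
  rw [← (EuclideanSpace.volume_preserving_symm_measurableEquiv_toLp (Fin 3)).integral_comp
    (MeasurableEquiv.measurableEmbedding _)]
  have h := integral_fun_norm_addHaar (volume : Measure (EuclideanSpace ℝ (Fin 3)))
    (fun r => Real.exp (-z / c * Real.sqrt (c ^ 2 + r ^ 2)))
  simp only [← energy_ofLp, finrank_euclideanSpace, Fintype.card_fin, Nat.add_one_sub_one,
    integral_radial hc hz, Measure.real, EuclideanSpace.volume_ball_fin_three] at h
  refine h.trans ?_
  rw [ENNReal.ofReal_one, one_pow, one_mul, ENNReal.toReal_ofReal (by positivity)]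
  simp only [nsmul_eq_mul, smul_eq_mul]
  push_cast
  ring

lemma integral_affine_mul_exp_energy {c z : ℝ} (hc : 0 < c) (hz : 0 < z) (α : ℝ)
    (β : Fin 3 → ℝ) :
    ∫ q : Fin 3 → ℝ, (α + dot3 q β / energy c q) * Real.exp (-z / c * energy c q) =
      α * (4 * Real.pi * c ^ 3 * Kb 2 z / z) := by
  have hW := integrable_exp_energy hc hz
  have hI : Integrable fun q : Fin 3 → ℝ =>
      dot3 q β / energy c q * Real.exp (-z / c * energy c q) := by
    refine hW.bdd_mul (c := energy c β) ?_ (Eventually.of_forall fun q => ?_)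
    · exact ((continuous_dot3 β).div (continuous_energy c)
        fun q => (energy_pos hc q).ne').aestronglyMeasurable
    · rw [Real.norm_eq_abs, abs_div, abs_of_pos (energy_pos hc q),
        div_le_iff₀ (energy_pos hc q), mul_comm]
      exact (abs_dot3_lt hc q β).le
  have hodd : ∫ q : Fin 3 → ℝ,
      dot3 q β / energy c q * Real.exp (-z / c * energy c q) = 0 := by
    have h := integral_neg_eq_self (fun q : Fin 3 → ℝ =>
      dot3 q β / energy c q * Real.exp (-z / c * energy c q)) volume
    have hneg (q : Fin 3 → ℝ) : dot3 (-q) β = -dot3 q β := by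
      simp only [dot3, Pi.neg_apply]; ring
    simp only [energy_neg, hneg, neg_div, neg_mul] at h
    rw [integral_neg] at h
    simp only [neg_div, neg_mul]
    linarith
  simp only [add_mul]
  rw [integral_add (hW.const_mul α) hI, hodd, integral_const_mul, integral_exp_energy hc hz,
    add_zero]

lemma energy_boost_neg {c : ℝ} (hc : 0 < c) (u q : Fin 3 → ℝ) :
    energy c (boost c (-u) q) = (energy c q * energy c u + dot3 q u) / c := by
  rw [energy_boost hc, energy_neg]
  simp only [dot3, Pi.neg_apply]
  ring

/-- Moments of the Jüttner distribution, computed in the rest frame. -/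
lemma integral_mul_Jutt {c T : ℝ} (hc : 0 < c) (u : Fin 3 → ℝ) (h : (Fin 3 → ℝ) → ℝ) :
    ∫ p, h p * Jutt c T u p = (c ^ 2 / T) / (4 * Real.pi * c ^ 3 * Kb 2 (c ^ 2 / T)) *
      ∫ q, h (boost c (-u) q) * (energy c (boost c (-u) q) / energy c q) *
        Real.exp (-(c ^ 2 / T) / c * energy c q) := by
  rw [← integral_comp_boost hc u (fun q => h _ * _ * _), ← integral_const_mul]
  congr with p
  rw [boost_neg_boost hc]
  have h1 := energy_pos hc p
  have h2 := energy_pos hc (boost c u p)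
  have hexp : -(c ^ 2 / T) / c * energy c (boost c u p) =
      -(c ^ 2 / T) * (energy c p * energy c u - dot3 p u) / c ^ 2 := by
    rw [energy_boost hc]
    ring
  rw [hexp, Jutt]
  rw [← energy, ← energy]
  field_simp

/-- Zeroth and first moments of the Jüttner distribution:
∫ J dp = u₀/c and ∫ (pᵢ/p₀) J dp = uᵢ/c. -/
theorem juttner_moments_zero_one (c T : ℝ) (hc : 0 < c) (hT : 0 < T) (u : Fin 3 → ℝ) :
    (∫ p : Fin 3 → ℝ, Jutt c T u p) = Real.sqrt (c ^ 2 + norm3 u ^ 2) / c ∧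
    ∀ i : Fin 3,
      (∫ p : Fin 3 → ℝ, (p i / Real.sqrt (c ^ 2 + norm3 p ^ 2)) * Jutt c T u p) =
        u i / c := by
  have hz : 0 < c ^ 2 / T := by positivity
  have hK := Kb_two_pos hz
  have hu := energy_pos hc u
  have normalize (α : ℝ) : (c ^ 2 / T) / (4 * Real.pi * c ^ 3 * Kb 2 (c ^ 2 / T)) *
      (α * (4 * Real.pi * c ^ 3 * Kb 2 (c ^ 2 / T) / (c ^ 2 / T))) = α := by
    have := Real.pi_pos
    generalize Kb 2 (c ^ 2 / T) = K at *
    field_simp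
  refine ⟨?_, fun i => ?_⟩
  · have h := integral_mul_Jutt (T := T) hc u fun _ => 1
    simp only [one_mul] at h
    rw [h, ← energy, ← normalize (energy c u / c),
      ← integral_affine_mul_exp_energy hc hz (energy c u / c) ((1 / c) • u)]
    congr 2 with q
    have := energy_pos hc q
    rw [energy_boost_neg hc]
    simp only [dot3, Pi.smul_apply, smul_eq_mul]
    field_simp
  · have h := integral_mul_Jutt (T := T) hc u fun p => p i / energy c p
    refine h.trans ?_
    rw [← normalize (u i / c), ← integral_affine_mul_exp_energy hc hz (u i / c)
      (Pi.single i 1 + (u i / (c * (c + energy c u))) • u)]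
    congr 2 with q
    have := energy_pos hc q
    have hb := energy_pos hc (boost c (-u) q)
    have hsingle : q i = dot3 q (Pi.single i 1) := by
      fin_cases i <;> simp [dot3]
    have hdot : dot3 q (Pi.single i 1 + (u i / (c * (c + energy c u))) • u) =
        q i + u i / (c * (c + energy c u)) * dot3 q u := by
      rw [hsingle]
      simp only [dot3, Pi.add_apply, Pi.smul_apply, smul_eq_mul]
      ring
    have hneg : dot3 q (-u) = -dot3 q u := by
      simp only [dot3, Pi.neg_apply]
      ring
    rw [hdot, div_mul_div_cancel₀ hb.ne', boost, energy_neg, hneg]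
    simp only [Pi.add_apply, Pi.smul_apply, Pi.neg_apply, smul_eq_mul]
    field_simp
    ring
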